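/- arXiv:1711.06674 — 4 statements merged into one kernel-verified Lean document; each statement's English description precedes it below -/
import Mathlib

section
/- Let m > 0. The ℂ-linear map Φ from test functions to ℂ² given by Φ(f) := (∫_ℝ exp(i·m·x)·f(x) dx, ∫_ℝ exp(−i·m·x)·f(x) dx) is surjective, and Φ(f) = (0, 0) if and only if there exists a test function h with f = h'' + m²·h. (Linear observables for the one-dimensional free scalar field, evaluated on solutions, form a two-dimensional space, with kernel exactly the image of the Klein–Gordon operator; this is the degree-zero content of the lemma identifying H⁰(PV(ℝ), d) with ℂ[p, q].) -/
open MeasureTheory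

/-- The evaluation map pairing a test function against the two basic solutions
`exp(±imx)` of the Klein–Gordon equation. -/
noncomputable def solEval (m : ℝ) (f : ℝ → ℂ) : ℂ × ℂ :=
  (∫ x : ℝ, Complex.exp (Complex.I * m * x) * f x,
   ∫ x : ℝ, Complex.exp (-Complex.I * m * x) * f x)

lemma contDiff_exp_mul (c : ℂ) : ContDiff ℝ (⊤ : ℕ∞) fun x : ℝ => Complex.exp (c * x) :=
  (contDiff_const.mul Complex.ofRealCLM.contDiff).cexp

lemma hasDerivAt_exp_mul (c : ℂ) (x : ℝ) :
    HasDerivAt (fun x : ℝ => Complex.exp (c * x)) (c * Complex.exp (c * x)) x := by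
  have h : HasDerivAt (fun x : ℝ => c * (x : ℂ)) (c * 1) x :=
    HasDerivAt.const_mul c (hasDerivAt_id x).ofReal_comp
  simpa [mul_comm] using h.cexp

lemma exp_neg_mul_mul_exp_mul (c : ℂ) (x : ℝ) :
    Complex.exp (-c * x) * Complex.exp (c * x) = 1 := by
  rw [← Complex.exp_add, neg_mul, neg_add_cancel, Complex.exp_zero]

/-- Smooth compactly supported functions `ℝ → ℂ`. -/
structure IsTestFunction (f : ℝ → ℂ) : Prop where
  contDiff : ContDiff ℝ (⊤ : ℕ∞) f
  hasCompactSupport : HasCompactSupport f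

namespace IsTestFunction

variable {f g : ℝ → ℂ}

lemma hasDerivAt (hf : IsTestFunction f) (x : ℝ) : HasDerivAt f (deriv f x) x :=
  (hf.contDiff.differentiable (by simp) x).hasDerivAt

lemma deriv (hf : IsTestFunction f) : IsTestFunction (deriv f) :=
  ⟨(contDiff_infty_iff_deriv.1 hf.contDiff).2, hf.hasCompactSupport.deriv⟩

lemma add (hf : IsTestFunction f) (hg : IsTestFunction g) :
    IsTestFunction fun x => f x + g x :=
  ⟨hf.contDiff.add hg.contDiff, hf.hasCompactSupport.add hg.hasCompactSupport⟩

lemma mul_left {u : ℝ → ℂ} (hu : ContDiff ℝ (⊤ : ℕ∞) u) (hf : IsTestFunction f) :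
    IsTestFunction fun x => u x * f x :=
  ⟨hu.mul hf.contDiff, hf.hasCompactSupport.mul_left⟩

lemma const_mul (c : ℂ) (hf : IsTestFunction f) : IsTestFunction fun x => c * f x :=
  hf.mul_left contDiff_const

lemma exp_mul (c : ℂ) (hf : IsTestFunction f) :
    IsTestFunction fun x => Complex.exp (c * x) * f x :=
  hf.mul_left (contDiff_exp_mul c)

lemma integrable (hf : IsTestFunction f) : Integrable f :=
  hf.contDiff.continuous.integrable_of_hasCompactSupport hf.hasCompactSupport

/-- A test function of integral zero has a primitive that is a test function. -/
lemma exists_deriv_eq (hf : IsTestFunction f) (h0 : ∫ x, f x = 0) :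
    ∃ g, IsTestFunction g ∧ ∀ x, HasDerivAt g (f x) x := by
  obtain ⟨R, hR⟩ := hf.hasCompactSupport.isCompact.isBounded.subset_closedBall 0
  have hsupp : ∀ x, R < |x| → f x = 0 := fun x hx =>
    image_eq_zero_of_notMem_tsupport fun h => by
      have := hR h
      rw [mem_closedBall_zero_iff, Real.norm_eq_abs] at this
      linarith
  have hder : ∀ x, HasDerivAt (fun x => ∫ t in (-(R + 1))..x, f t) (f x) x := fun x =>
    hf.contDiff.continuous.integral_hasStrictDerivAt _ x |>.hasDerivAt
  refine ⟨fun x => ∫ t in (-(R + 1))..x, f t, ⟨?_, ?_⟩, hder⟩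
  · refine contDiff_infty_iff_deriv.2 ⟨fun x => (hder x).differentiableAt, ?_⟩
    rw [show _root_.deriv _ = f from funext fun x => (hder x).deriv]
    exact hf.contDiff
  · refine HasCompactSupport.intro (isCompact_closedBall (0 : ℝ) (R + 1)) fun x hx => ?_
    rw [mem_closedBall_zero_iff, Real.norm_eq_abs, not_le, lt_abs] at hx
    rcases hx with hx | hx
    · rw [intervalIntegral.integral_eq_integral_of_support_subset, h0]
      intro t ht
      have : |t| ≤ R := not_lt.1 fun h => ht (hsupp t h)
      rw [abs_le] at this
      constructor <;> linarith
    · refine intervalIntegral.integral_zero_ae (Filter.Eventually.of_forall fun t ht => hsupp t ?_)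
      rw [Set.uIoc_of_ge (by linarith)] at ht
      rw [lt_abs]
      right
      linarith [ht.2]

lemma integral_exp_mul_deriv_add (hf : IsTestFunction f) (c d : ℂ) :
    ∫ x : ℝ, Complex.exp (c * x) * (_root_.deriv f x + d * f x) =
      (d - c) * ∫ x : ℝ, Complex.exp (c * x) * f x := by
  have key : ∫ x : ℝ, (Complex.exp (c * x) * _root_.deriv f x +
      c * Complex.exp (c * x) * f x) = 0 := by
    refine integral_eq_zero_of_hasDerivAt_of_integrable
      (f := fun x : ℝ => Complex.exp (c * x) * f x) (fun x => ?_) ?_ (hf.exp_mul c).integrable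
    · rw [add_comm]
      exact (hasDerivAt_exp_mul c x).mul (hf.hasDerivAt x)
    · simpa only [mul_assoc] using
        ((hf.deriv.exp_mul c).add ((hf.exp_mul c).const_mul c)).integrable
  rw [← integral_const_mul, ← zero_add (∫ x : ℝ, (d - c) * _), ← key, ← integral_add]
  · congr 1 with x
    ring
  · simpa only [mul_assoc] using
      ((hf.deriv.exp_mul c).add ((hf.exp_mul c).const_mul c)).integrable
  · exact ((hf.exp_mul c).const_mul _).integrable

/-- The equation `g' + c g = f` is solvable in test functions once `f` is orthogonal to
`exp (c x)`. -/
lemma exists_deriv_add_eq (hf : IsTestFunction f) (c : ℂ)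
    (h0 : ∫ x : ℝ, Complex.exp (c * x) * f x = 0) :
    ∃ g, IsTestFunction g ∧ f = fun x => _root_.deriv g x + c * g x := by
  obtain ⟨g, hg, hder⟩ := (hf.exp_mul c).exists_deriv_eq h0
  refine ⟨_, hg.exp_mul (-c), funext fun x => ?_⟩
  have h := ((hasDerivAt_exp_mul (-c) x).mul (hder x)).deriv
  simp only [Pi.mul_def] at h
  rw [h]
  linear_combination -f x * exp_neg_mul_mul_exp_mul c x

/-- Some test function takes prescribed value against `exp (c x)` and vanishes against
`exp (d x)`. -/
lemma exists_integral_exp_mul_eq {c d : ℂ} (hcd : c ≠ d) (z : ℂ) :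
    ∃ f, IsTestFunction f ∧ ∫ x : ℝ, Complex.exp (c * x) * f x = z ∧
      ∫ x : ℝ, Complex.exp (d * x) * f x = 0 := by
  let φ : ContDiffBump (0 : ℝ) := ⟨1, 2, one_pos, one_lt_two⟩
  have hφ : IsTestFunction fun x => (φ.normed volume x : ℂ) :=
    ⟨Complex.ofRealCLM.contDiff.comp φ.contDiff_normed,
      φ.hasCompactSupport_normed.comp_left (g := Complex.ofReal) Complex.ofReal_zero⟩
  have hψ := (hφ.exp_mul (-c)).const_mul (z / (d - c))
  refine ⟨_, hψ.deriv.add (hψ.const_mul d), ?_, ?_⟩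
  · rw [hψ.integral_exp_mul_deriv_add]
    have : ∀ x : ℝ, Complex.exp (c * x) *
        (z / (d - c) * (Complex.exp (-c * x) * (φ.normed volume x : ℂ))) =
        z / (d - c) * (φ.normed volume x : ℂ) := fun x => by
      linear_combination z / (d - c) * (φ.normed volume x : ℂ) * exp_neg_mul_mul_exp_mul c x
    simp_rw [this]
    rw [integral_const_mul, integral_complex_ofReal, φ.integral_normed, Complex.ofReal_one,
      mul_one, mul_div_cancel₀ _ (sub_ne_zero.2 hcd.symm)]
  · rw [hψ.integral_exp_mul_deriv_add, sub_self, zero_mul]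

lemma deriv_deriv_add_mul (hf : IsTestFunction f) (c : ℂ) (x : ℝ) :
    _root_.deriv (fun t => _root_.deriv f t + c * f t) x + -c * (_root_.deriv f x + c * f x) =
      _root_.deriv (_root_.deriv f) x - c ^ 2 * f x := by
  have h : HasDerivAt (fun t => _root_.deriv f t + c * f t) _ x :=
    (hf.deriv.hasDerivAt x).add ((hf.hasDerivAt x).const_mul c)
  rw [h.deriv]
  ring

lemma integral_exp_mul_deriv_deriv (hf : IsTestFunction f) (c : ℂ) :
    ∫ x : ℝ, Complex.exp (c * x) * (_root_.deriv (_root_.deriv f) x - c ^ 2 * f x) = 0 := by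
  have hg := hf.deriv.add (hf.const_mul (-c))
  have h := hg.integral_exp_mul_deriv_add c c
  rw [sub_self, zero_mul] at h
  rw [← h]
  congr 1 with x
  have := hf.deriv_deriv_add_mul (-c) x
  rw [neg_neg, neg_sq] at this
  rw [this]

end IsTestFunction

/-- The map `Φ(f) = (∫ e^{imx} f, ∫ e^{-imx} f)` from test
functions to `ℂ²` is surjective, and `Φ(f) = 0` iff `f` is in the image of the
Klein–Gordon operator on test functions. -/
theorem linear_observables_on_solutions (m : ℝ) (hm : 0 < m) :
    (∀ z : ℂ × ℂ, ∃ f : ℝ → ℂ, ContDiff ℝ (⊤ : ℕ∞) f ∧ HasCompactSupport f ∧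
      solEval m f = z) ∧
    (∀ f : ℝ → ℂ, ContDiff ℝ (⊤ : ℕ∞) f → HasCompactSupport f →
      (solEval m f = (0, 0) ↔
        ∃ h : ℝ → ℂ, ContDiff ℝ (⊤ : ℕ∞) h ∧ HasCompactSupport h ∧
          f = fun t => deriv (deriv h) t + (m : ℂ) ^ 2 * h t)) := by
  have hc : Complex.I * m ≠ -Complex.I * m := by
    have : (m : ℂ) ≠ 0 := by exact_mod_cast hm.ne'
    rw [neg_mul, ne_eq, self_eq_neg]
    exact mul_ne_zero Complex.I_ne_zero this
  have hsq : (Complex.I * m) ^ 2 = -(m : ℂ) ^ 2 := by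
    rw [mul_pow, Complex.I_sq, neg_one_mul]
  refine ⟨fun z => ?_, fun f hf hfc => ⟨fun h => ?_, ?_⟩⟩
  · obtain ⟨f, hf, hf₁, hf₂⟩ := IsTestFunction.exists_integral_exp_mul_eq hc z.1
    obtain ⟨g, hg, hg₁, hg₂⟩ := IsTestFunction.exists_integral_exp_mul_eq hc.symm z.2
    refine ⟨_, (hf.add hg).contDiff, (hf.add hg).hasCompactSupport, ?_⟩
    simp only [solEval, mul_add]
    rw [integral_add (hf.exp_mul _).integrable (hg.exp_mul _).integrable,
      integral_add (hf.exp_mul _).integrable (hg.exp_mul _).integrable, hf₁, hf₂, hg₁, hg₂,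
      add_zero, zero_add]
  · obtain ⟨h₁, h₂⟩ := Prod.mk.inj h
    obtain ⟨g, hg, rfl⟩ := IsTestFunction.exists_deriv_add_eq ⟨hf, hfc⟩ _ h₂
    rw [hg.integral_exp_mul_deriv_add] at h₁
    obtain ⟨u, hu, rfl⟩ := hg.exists_deriv_add_eq _
      ((mul_eq_zero.1 h₁).resolve_left (sub_ne_zero.2 hc.symm))
    refine ⟨u, hu.contDiff, hu.hasCompactSupport, funext fun x => ?_⟩
    rw [neg_mul Complex.I, hu.deriv_deriv_add_mul, hsq]
    ring
  · rintro ⟨u, hu, huc, rfl⟩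
    have hu : IsTestFunction u := ⟨hu, huc⟩
    have h₁ := hu.integral_exp_mul_deriv_deriv (Complex.I * m)
    have h₂ := hu.integral_exp_mul_deriv_deriv (-Complex.I * m)
    rw [neg_mul, neg_sq, ← neg_mul] at h₂
    simp only [hsq, neg_mul, sub_neg_eq_add] at h₁ h₂
    simp only [solEval, neg_mul, h₁, h₂]
end

section
/- Let m > 0, let f be a test function, and set u := G^R f. Let c ≤ d be real numbers with f(t) = 0 for all t ≥ d, and let χ : ℝ → ℝ be a smooth function with χ(t) = 1 for all t ≤ c and χ(t) = 0 for all t ≥ d. Then g := f − ((χ·u)'' + m²·(χ·u)) is a test function with g(t) = 0 for every t outside the interval [c, d]. (The support part of the time-slice construction: the observable O_f can be replaced by an observable supported in an arbitrarily thin neighborhood of a Cauchy surface.) -/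
open MeasureTheory

/-- The retarded propagator `(G^R f)(t) = (1/m) ∫_{-∞}^t sin(m (t - s)) f(s) ds`. -/
noncomputable def retardedProp (m : ℝ) (f : ℝ → ℂ) (t : ℝ) : ℂ :=
  (1 / (m : ℂ)) * ∫ s in Set.Iic t, Complex.sin (((m * (t - s) : ℝ) : ℂ)) * f s

theorem hasDerivAt_setIntegral_Iic {h : ℝ → ℂ} (hc : Continuous h) (hi : Integrable h)
    (t : ℝ) : HasDerivAt (fun x => ∫ s in Set.Iic x, h s) (h t) t := by
  have heq : (fun x => ∫ s in Set.Iic x, h s) =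
      fun x => (∫ s in Set.Iic (0 : ℝ), h s) + ∫ s in (0 : ℝ)..x, h s := by
    funext x
    rw [← intervalIntegral.integral_Iic_sub_Iic hi.integrableOn hi.integrableOn]
    ring
  rw [heq]
  exact (intervalIntegral.integral_hasDerivAt_right (hc.intervalIntegrable _ _)
    hc.stronglyMeasurable.stronglyMeasurableAtFilter hc.continuousAt).const_add _

theorem contDiff_setIntegral_Iic {h : ℝ → ℂ} (hc : ContDiff ℝ (⊤ : ℕ∞) h)
    (hi : Integrable h) : ContDiff ℝ (⊤ : ℕ∞) (fun x => ∫ s in Set.Iic x, h s) := by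
  have hd := hasDerivAt_setIntegral_Iic hc.continuous hi
  rw [contDiff_infty_iff_deriv]
  refine ⟨fun t => (hd t).differentiableAt, ?_⟩
  rwa [show deriv (fun x => ∫ s in Set.Iic x, h s) = h from funext fun t => (hd t).deriv]

theorem contDiff_sin_ofReal_mul (m : ℝ) :
    ContDiff ℝ (⊤ : ℕ∞) (fun t : ℝ => Complex.sin ((m : ℂ) * t)) :=
  (Complex.contDiff_sin.restrict_scalars ℝ).comp
    (contDiff_const.mul Complex.ofRealCLM.contDiff)

theorem contDiff_cos_ofReal_mul (m : ℝ) :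
    ContDiff ℝ (⊤ : ℕ∞) (fun t : ℝ => Complex.cos ((m : ℂ) * t)) :=
  (Complex.contDiff_cos.restrict_scalars ℝ).comp
    (contDiff_const.mul Complex.ofRealCLM.contDiff)

theorem hasDerivAt_sin_ofReal_mul (m t : ℝ) :
    HasDerivAt (fun t : ℝ => Complex.sin ((m : ℂ) * t)) (Complex.cos ((m : ℂ) * t) * m) t := by
  have h := ((hasDerivAt_id (t : ℂ)).const_mul (m : ℂ)).csin.comp_ofReal
  simpa using h

theorem hasDerivAt_cos_ofReal_mul (m t : ℝ) :
    HasDerivAt (fun t : ℝ => Complex.cos ((m : ℂ) * t)) (-Complex.sin ((m : ℂ) * t) * m) t := by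
  have h := ((hasDerivAt_id (t : ℂ)).const_mul (m : ℂ)).ccos.comp_ofReal
  simpa using h

theorem retardedProp_eq (m : ℝ) {f : ℝ → ℂ} (hf : Continuous f)
    (hfsupp : HasCompactSupport f) :
    retardedProp m f = fun t : ℝ => (1 / (m : ℂ)) *
      (Complex.sin (m * t) * (∫ s in Set.Iic t, Complex.cos (m * s) * f s)
        - Complex.cos (m * t) * ∫ s in Set.Iic t, Complex.sin (m * s) * f s) := by
  have hci : Integrable fun s : ℝ => Complex.cos (m * s) * f s :=
    ((contDiff_cos_ofReal_mul m).continuous.mul hf).integrable_of_hasCompactSupport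
      hfsupp.mul_left
  have hsi : Integrable fun s : ℝ => Complex.sin (m * s) * f s :=
    ((contDiff_sin_ofReal_mul m).continuous.mul hf).integrable_of_hasCompactSupport
      hfsupp.mul_left
  funext t
  unfold retardedProp
  rw [← integral_const_mul (Complex.sin _), ← integral_const_mul (Complex.cos _),
    ← integral_sub (hci.integrableOn.const_mul _) (hsi.integrableOn.const_mul _)]
  congr 2
  funext s
  push_cast
  rw [mul_sub, Complex.sin_sub]
  ring

theorem contDiff_retardedProp (m : ℝ) {f : ℝ → ℂ} (hf : ContDiff ℝ (⊤ : ℕ∞) f)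
    (hfsupp : HasCompactSupport f) : ContDiff ℝ (⊤ : ℕ∞) (retardedProp m f) := by
  have hs := contDiff_sin_ofReal_mul m
  have hc := contDiff_cos_ofReal_mul m
  rw [retardedProp_eq m hf.continuous hfsupp]
  exact contDiff_const.mul
    ((hs.mul (contDiff_setIntegral_Iic (hc.mul hf)
      ((hc.mul hf).continuous.integrable_of_hasCompactSupport hfsupp.mul_left))).sub
    (hc.mul (contDiff_setIntegral_Iic (hs.mul hf)
      ((hs.mul hf).continuous.integrable_of_hasCompactSupport hfsupp.mul_left))))

theorem deriv_deriv_retardedProp {m : ℝ} (hm : m ≠ 0) {f : ℝ → ℂ} (hf : Continuous f)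
    (hfsupp : HasCompactSupport f) (t : ℝ) :
    deriv (deriv (retardedProp m f)) t = f t - (m : ℂ) ^ 2 * retardedProp m f t := by
  have hm' : (m : ℂ) ≠ 0 := Complex.ofReal_ne_zero.mpr hm
  have hcf : Continuous fun s : ℝ => Complex.cos (m * s) * f s :=
    (contDiff_cos_ofReal_mul m).continuous.mul hf
  have hsf : Continuous fun s : ℝ => Complex.sin (m * s) * f s :=
    (contDiff_sin_ofReal_mul m).continuous.mul hf
  have hA := hasDerivAt_setIntegral_Iic hcf (hcf.integrable_of_hasCompactSupport hfsupp.mul_left)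
  have hB := hasDerivAt_setIntegral_Iic hsf (hsf.integrable_of_hasCompactSupport hfsupp.mul_left)
  have hS := hasDerivAt_sin_ofReal_mul m
  have hC := hasDerivAt_cos_ofReal_mul m
  rw [retardedProp_eq m hf hfsupp]
  have hd : deriv (fun t : ℝ => (1 / (m : ℂ)) *
      (Complex.sin (m * t) * (∫ s in Set.Iic t, Complex.cos (m * s) * f s)
        - Complex.cos (m * t) * ∫ s in Set.Iic t, Complex.sin (m * s) * f s)) =
      fun t : ℝ => Complex.cos (m * t) * (∫ s in Set.Iic t, Complex.cos (m * s) * f s)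
        + Complex.sin (m * t) * ∫ s in Set.Iic t, Complex.sin (m * s) * f s := by
    funext x
    refine ((((hS x).mul (hA x)).sub ((hC x).mul (hB x))).const_mul (1 / (m : ℂ))).deriv.trans ?_
    field_simp
    ring
  rw [hd]
  refine (((hC t).mul (hA t)).add ((hS t).mul (hB t))).deriv.trans ?_
  field_simp
  linear_combination f t * Complex.sin_sq_add_cos_sq ((m : ℂ) * t)

/-- The time-slice construction: with `u = G^R f`, the modified
test function `g = f - P(χ · u)` is smooth, compactly supported, and supported
inside the slice `[c, d]`. -/
theorem time_slice_support (m : ℝ) (hm : 0 < m)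
    (f : ℝ → ℂ) (hf : ContDiff ℝ (⊤ : ℕ∞) f) (hfsupp : HasCompactSupport f)
    (c d : ℝ) (hcd : c ≤ d) (hfd : ∀ t : ℝ, d ≤ t → f t = 0)
    (χ : ℝ → ℝ) (hχ : ContDiff ℝ (⊤ : ℕ∞) χ)
    (hχ1 : ∀ t : ℝ, t ≤ c → χ t = 1) (hχ0 : ∀ t : ℝ, d ≤ t → χ t = 0) :
    letI u : ℝ → ℂ := retardedProp m f
    letI g : ℝ → ℂ := fun t =>
      f t - (deriv (deriv (fun s : ℝ => (χ s : ℂ) * u s)) t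
              + (m : ℂ) ^ 2 * ((χ t : ℂ) * u t))
    ContDiff ℝ (⊤ : ℕ∞) g ∧ HasCompactSupport g ∧
      ∀ t : ℝ, t ∉ Set.Icc c d → g t = 0 := by
  have hu := contDiff_retardedProp m hf hfsupp
  have hχu : ContDiff ℝ (⊤ : ℕ∞) fun s : ℝ => (χ s : ℂ) * retardedProp m f s :=
    (Complex.ofRealCLM.contDiff.comp hχ).mul hu
  have hzero : ∀ t : ℝ, t ∉ Set.Icc c d →
      f t - (deriv (deriv (fun s : ℝ => (χ s : ℂ) * retardedProp m f s)) t
        + (m : ℂ) ^ 2 * ((χ t : ℂ) * retardedProp m f t)) = 0 := by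
    intro t ht
    rcases lt_or_ge t c with htc | htc
    · have hloc : (fun s : ℝ => (χ s : ℂ) * retardedProp m f s) =ᶠ[nhds t] retardedProp m f := by
        filter_upwards [Iio_mem_nhds htc] with s hs
        simp [hχ1 s (le_of_lt hs)]
      rw [hloc.deriv.deriv_eq, deriv_deriv_retardedProp hm.ne' hf.continuous hfsupp,
        hχ1 t htc.le]
      push_cast
      ring
    · have htd : d < t := lt_of_not_ge fun h => ht ⟨htc, h⟩
      have hloc : (fun s : ℝ => (χ s : ℂ) * retardedProp m f s) =ᶠ[nhds t] fun _ => 0 := by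
        filter_upwards [Ioi_mem_nhds htd] with s hs
        simp [hχ0 s (le_of_lt hs)]
      rw [hloc.deriv.deriv_eq, hχ0 t htd.le, hfd t htd.le]
      simp
  exact ⟨hf.sub (((contDiff_infty_iff_deriv.mp (contDiff_infty_iff_deriv.mp hχu).2).2).add
    (contDiff_const.mul hχu)), HasCompactSupport.intro isCompact_Icc hzero, hzero⟩
end

section
/- Fix n ∈ ℕ, a complex number ħ, a matrix C : Fin n → Fin n → ℂ, and a symmetric matrix D : Fin n → Fin n → ℂ (D i j = D j i). Define the second-order operator L_D F := Σ_{i,j} D i j · ∂_i ∂_j F and the exponential map α_D F := Σ_{k ≥ 0} ((ħ/2)ᵏ / k!) · L_Dᵏ F (a finite sum on each polynomial). Then for all polynomials F, G one has α_D (F ⋆_C G) = (α_D F) ⋆_{C+D} (α_D G); in particular α_D is an algebra isomorphism from (ℂ[X₀,…,X_{n−1}], ⋆_C) to (ℂ[X₀,…,X_{n−1}], ⋆_{C+D}). -/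
open MvPolynomial

/-- The iterated partial derivative of a multivariate polynomial. -/
noncomputable def pderivMulti {n k : ℕ} (i : Fin k → Fin n)
    (F : MvPolynomial (Fin n) ℂ) : MvPolynomial (Fin n) ℂ :=
  (List.ofFn i).foldl (fun p r => MvPolynomial.pderiv r p) F

/-- The exponential product `F ⋆_C G` determined by a propagator matrix `C`. -/
noncomputable def expProd {n : ℕ} (hbar : ℂ) (C : Fin n → Fin n → ℂ)
    (F G : MvPolynomial (Fin n) ℂ) : MvPolynomial (Fin n) ℂ :=
  ∑ᶠ k : ℕ, (hbar ^ k / (k.factorial : ℂ)) •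
    ∑ i : Fin k → Fin n, ∑ j : Fin k → Fin n,
      (∏ a : Fin k, C (i a) (j a)) • (pderivMulti i F * pderivMulti j G)

/-- The second-order operator `L_D F = Σ_{i,j} D i j · ∂_i ∂_j F`. -/
noncomputable def secondOrderOp {n : ℕ} (D : Fin n → Fin n → ℂ)
    (F : MvPolynomial (Fin n) ℂ) : MvPolynomial (Fin n) ℂ :=
  ∑ i : Fin n, ∑ j : Fin n,
    D i j • MvPolynomial.pderiv i (MvPolynomial.pderiv j F)

/-- The exponential map `α_D = exp((ħ/2) L_D)`; on each polynomial the sum is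
finite since `L_D` lowers degree. -/
noncomputable def expAlpha {n : ℕ} (hbar : ℂ) (D : Fin n → Fin n → ℂ)
    (F : MvPolynomial (Fin n) ℂ) : MvPolynomial (Fin n) ℂ :=
  ∑ᶠ k : ℕ, ((hbar / 2) ^ k / (k.factorial : ℂ)) • (secondOrderOp D)^[k] F

/-- A linear endomorphism is locally nilpotent if every vector is killed by one of its powers. -/
def IsLocallyNilpotent {K V : Type*} [Field K] [AddCommGroup V] [Module K V]
    (T : Module.End K V) : Prop :=
  ∀ v, ∃ k : ℕ, (T ^ k) v = 0

/-- The exponential of an endomorphism, meaningful when it is locally nilpotent. -/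
noncomputable def locExp {K V : Type*} [Field K] [AddCommGroup V] [Module K V]
    (T : Module.End K V) (v : V) : V :=
  ∑ᶠ k : ℕ, ((k.factorial : K)⁻¹) • (T ^ k) v

section LocallyNilpotent

variable {K V W : Type*} [Field K] [AddCommGroup V] [Module K V] [AddCommGroup W] [Module K W]

theorem Module.End.pow_apply_eq_zero_of_le {T : Module.End K V} {v : V} {k l : ℕ}
    (h : (T ^ k) v = 0) (hkl : k ≤ l) : (T ^ l) v = 0 := by
  rw [← Nat.sub_add_cancel hkl, pow_add, Module.End.mul_apply, h, map_zero]

theorem Commute.end_pow_mul_pow_apply_eq_zero {S T : Module.End K V} (h : Commute S T) {v : V}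
    {N i j : ℕ} (hS : (S ^ N) v = 0) (hT : (T ^ N) v = 0) (hij : N ≤ i ∨ N ≤ j) :
    (S ^ i * T ^ j) v = 0 := by
  rcases hij with hi | hj
  · rw [(h.pow_pow i j).eq, Module.End.mul_apply,
      Module.End.pow_apply_eq_zero_of_le hS hi, map_zero]
  · rw [Module.End.mul_apply, Module.End.pow_apply_eq_zero_of_le hT hj, map_zero]

namespace IsLocallyNilpotent

variable {S T : Module.End K V}

theorem exists_common (hS : IsLocallyNilpotent S) (hT : IsLocallyNilpotent T) (v : V) :
    ∃ N : ℕ, (S ^ N) v = 0 ∧ (T ^ N) v = 0 := by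
  obtain ⟨k, hk⟩ := hS v
  obtain ⟨l, hl⟩ := hT v
  exact ⟨max k l, Module.End.pow_apply_eq_zero_of_le hk (le_max_left _ _),
    Module.End.pow_apply_eq_zero_of_le hl (le_max_right _ _)⟩

theorem zero : IsLocallyNilpotent (0 : Module.End K V) := fun v => ⟨1, by simp⟩

theorem smul (hT : IsLocallyNilpotent T) (c : K) : IsLocallyNilpotent (c • T) := fun v => by
  obtain ⟨k, hk⟩ := hT v
  exact ⟨k, by rw [smul_pow, LinearMap.smul_apply, hk, smul_zero]⟩

theorem mul_of_commute (hT : IsLocallyNilpotent T) (h : Commute S T) :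
    IsLocallyNilpotent (S * T) := fun v => by
  obtain ⟨k, hk⟩ := hT v
  exact ⟨k, by rw [h.mul_pow, Module.End.mul_apply, hk, map_zero]⟩

theorem add_of_commute (hS : IsLocallyNilpotent S) (hT : IsLocallyNilpotent T)
    (h : Commute S T) : IsLocallyNilpotent (S + T) := fun v => by
  obtain ⟨N, hSN, hTN⟩ := hS.exists_common hT v
  refine ⟨N + N, ?_⟩
  rw [h.add_pow', LinearMap.sum_apply]
  refine Finset.sum_eq_zero fun p hp => ?_
  rw [LinearMap.smul_apply, h.end_pow_mul_pow_apply_eq_zero hSN hTN, smul_zero]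
  have := Finset.HasAntidiagonal.mem_antidiagonal.1 hp
  omega

theorem exists_add {x y : V} (hx : ∃ k : ℕ, (T ^ k) x = 0) (hy : ∃ k : ℕ, (T ^ k) y = 0) :
    ∃ k : ℕ, (T ^ k) (x + y) = 0 := by
  obtain ⟨k, hk⟩ := hx
  obtain ⟨l, hl⟩ := hy
  exact ⟨max k l, by
    rw [map_add, Module.End.pow_apply_eq_zero_of_le hk (le_max_left _ _),
      Module.End.pow_apply_eq_zero_of_le hl (le_max_right _ _), add_zero]⟩

theorem sum_of_commute {ι : Type*} (s : Finset ι) (f : ι → Module.End K V)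
    (hf : ∀ i ∈ s, IsLocallyNilpotent (f i)) (hc : ∀ i ∈ s, ∀ j ∈ s, Commute (f i) (f j)) :
    IsLocallyNilpotent (∑ i ∈ s, f i) := by
  classical
  induction s using Finset.induction_on with
  | empty => simpa using zero
  | insert a s ha ih =>
    rw [Finset.sum_insert ha]
    refine (hf a (Finset.mem_insert_self a s)).add_of_commute
      (ih (fun i hi => hf i (Finset.mem_insert_of_mem hi))
        fun i hi j hj => hc i (Finset.mem_insert_of_mem hi) j (Finset.mem_insert_of_mem hj)) ?_
    exact Commute.sum_right _ _ _ fun i hi =>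
      hc a (Finset.mem_insert_self a s) i (Finset.mem_insert_of_mem hi)

open scoped TensorProduct in
theorem map_left {A : Module.End K V} (hA : IsLocallyNilpotent A) (B : Module.End K W) :
    IsLocallyNilpotent (TensorProduct.map A B : Module.End K (V ⊗[K] W)) := by
  intro x
  induction x with
  | zero => exact ⟨0, map_zero _⟩
  | tmul v w =>
    obtain ⟨k, hk⟩ := hA v
    exact ⟨k, by rw [TensorProduct.map_pow, TensorProduct.map_tmul, hk, TensorProduct.zero_tmul]⟩
  | add x y hx hy => exact exists_add hx hy

open scoped TensorProduct in
theorem map_right (A : Module.End K V) {B : Module.End K W} (hB : IsLocallyNilpotent B) :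
    IsLocallyNilpotent (TensorProduct.map A B : Module.End K (V ⊗[K] W)) := by
  intro x
  induction x with
  | zero => exact ⟨0, map_zero _⟩
  | tmul v w =>
    obtain ⟨k, hk⟩ := hB w
    exact ⟨k, by rw [TensorProduct.map_pow, TensorProduct.map_tmul, hk, TensorProduct.tmul_zero]⟩
  | add x y hx hy => exact exists_add hx hy

end IsLocallyNilpotent

open scoped TensorProduct in
theorem Commute.tensorProductMap {A A' : Module.End K V} {B B' : Module.End K W}
    (hA : Commute A A') (hB : Commute B B') :
    Commute (TensorProduct.map A B : Module.End K (V ⊗[K] W)) (TensorProduct.map A' B') := by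
  rw [commute_iff_eq, ← TensorProduct.map_mul, ← TensorProduct.map_mul, hA.eq, hB.eq]

theorem Commute.sum_smul {ι κ : Type*} [Fintype ι] [Fintype κ] {f : ι → Module.End K V}
    {g : κ → Module.End K V} (h : ∀ i j, Commute (f i) (g j)) (c : ι → K) (d : κ → K) :
    Commute (∑ i, c i • f i) (∑ j, d j • g j) :=
  Commute.sum_left _ _ _ fun i _ => Commute.sum_right _ _ _ fun j _ =>
    ((h i j).smul_left _).smul_right _

theorem locExp_eq_sum {T : Module.End K V} {v : V} {N : ℕ} (h : (T ^ N) v = 0) :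
    locExp T v = ∑ k ∈ Finset.range N, ((k.factorial : K)⁻¹) • (T ^ k) v := by
  refine finsum_eq_sum_of_support_subset _ fun k hk => ?_
  by_contra hkN
  refine hk ?_
  simp only [Finset.coe_range, Set.mem_Iio, not_lt] at hkN
  simp only [Module.End.pow_apply_eq_zero_of_le h hkN, smul_zero]

/-- A linear map applied to an exponential, term by term. -/
theorem map_locExp_eq_finsum {T : Module.End K V} (hT : IsLocallyNilpotent T) (f : V →ₗ[K] W)
    (v : V) : f (locExp T v) = ∑ᶠ k : ℕ, ((k.factorial : K)⁻¹) • f ((T ^ k) v) := by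
  obtain ⟨N, hN⟩ := hT v
  rw [locExp_eq_sum hN, map_sum, finsum_eq_sum_of_support_subset (s := Finset.range N)]
  · simp only [map_smul]
  · intro k hk
    by_contra hkN
    refine hk ?_
    simp only [Finset.coe_range, Set.mem_Iio, not_lt] at hkN
    simp only [Module.End.pow_apply_eq_zero_of_le hN hkN, map_zero, smul_zero]

theorem locExp_zero (v : V) : locExp (0 : Module.End K V) v = v := by
  rw [locExp_eq_sum (N := 1) (by simp)]
  simp

/-- A linear map intertwining two endomorphisms intertwines their exponentials. -/
theorem map_locExp {S : Module.End K V} {T : Module.End K W} (hS : IsLocallyNilpotent S)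
    (f : V →ₗ[K] W) (h : ∀ v, f (S v) = T (f v)) (v : V) :
    f (locExp S v) = locExp T (f v) := by
  have hpow : ∀ (k : ℕ) (v : V), f ((S ^ k) v) = (T ^ k) (f v) := fun k => by
    induction k with
    | zero => simp
    | succ k ih => intro v; rw [pow_succ, pow_succ, Module.End.mul_apply, ih, h,
        Module.End.mul_apply]
  obtain ⟨N, hN⟩ := hS v
  rw [locExp_eq_sum hN, locExp_eq_sum (N := N) (by rw [← hpow, hN, map_zero]), map_sum]
  simp only [map_smul, hpow]

theorem locExp_add [CharZero K] {S T : Module.End K V} (hS : IsLocallyNilpotent S)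
    (hT : IsLocallyNilpotent T) (h : Commute S T) (v : V) :
    locExp (S + T) v = locExp S (locExp T v) := by
  obtain ⟨N, hSN, hTN⟩ := hS.exists_common hT v
  have hvanish := fun i j => h.end_pow_mul_pow_apply_eq_zero (i := i) (j := j) hSN hTN
  have hST : (S ^ N) (locExp T v) = 0 := by
    rw [locExp_eq_sum hTN, map_sum]
    refine Finset.sum_eq_zero fun j _ => ?_
    rw [map_smul, ← Module.End.mul_apply, hvanish N j (Or.inl le_rfl), smul_zero]
  have hadd : ((S + T) ^ (N + N)) v = 0 := by
    rw [h.add_pow', LinearMap.sum_apply]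
    refine Finset.sum_eq_zero fun p hp => ?_
    have := Finset.HasAntidiagonal.mem_antidiagonal.1 hp
    rw [LinearMap.smul_apply, hvanish p.1 p.2 (by omega), smul_zero]
  let a : ℕ × ℕ → V := fun p =>
    ((p.1.factorial : K)⁻¹ * (p.2.factorial : K)⁻¹) • (S ^ p.1 * T ^ p.2) v
  have hR : locExp S (locExp T v) = ∑ p ∈ Finset.range N ×ˢ Finset.range N, a p := by
    rw [locExp_eq_sum hST, locExp_eq_sum hTN, Finset.sum_product]
    refine Finset.sum_congr rfl fun i _ => ?_
    rw [map_sum, Finset.smul_sum]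
    refine Finset.sum_congr rfl fun j _ => ?_
    rw [map_smul, smul_smul]
    rfl
  rw [hR, locExp_eq_sum hadd, ← Finset.sum_fiberwise_of_maps_to
    (t := Finset.range (N + N)) (g := fun p : ℕ × ℕ => p.1 + p.2)]
  · refine Finset.sum_congr rfl fun k _ => ?_
    have hk : ((k.factorial : K)⁻¹) • ((S + T) ^ k) v =
        ∑ p ∈ Finset.HasAntidiagonal.antidiagonal k, a p := by
      rw [h.add_pow', LinearMap.sum_apply, Finset.smul_sum]
      refine Finset.sum_congr rfl fun p hp => ?_
      obtain rfl := Finset.HasAntidiagonal.mem_antidiagonal.1 hp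
      rw [LinearMap.smul_apply, ← Nat.cast_smul_eq_nsmul K, smul_smul, Nat.cast_add_choose]
      congr 1
      have := Nat.cast_ne_zero (R := K).2 (Nat.factorial_ne_zero (p.1 + p.2))
      field_simp
    rw [hk]
    symm
    refine Finset.sum_subset (fun p hp => ?_) fun p hp hp' => ?_
    · simpa using (Finset.mem_filter.1 hp).2
    · simp only [Finset.mem_filter, Finset.mem_product, Finset.mem_range] at hp'
      have := Finset.HasAntidiagonal.mem_antidiagonal.1 hp
      simp only [a, hvanish p.1 p.2 (by omega), smul_zero]
  · intro p hp
    simp only [Finset.mem_product, Finset.mem_range] at hp ⊢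
    omega

open scoped TensorProduct in
theorem locExp_tmul [CharZero K] {S : Module.End K V} {T : Module.End K W}
    (hS : IsLocallyNilpotent S) (hT : IsLocallyNilpotent T) (v : V) (w : W) :
    locExp (TensorProduct.map S 1 + TensorProduct.map 1 T : Module.End K (V ⊗[K] W)) (v ⊗ₜ w) =
      locExp S v ⊗ₜ locExp T w := by
  have hT' := map_locExp (T := TensorProduct.map 1 T) hT (TensorProduct.mk K V W v)
    (fun _ => rfl) w
  have hS' := map_locExp (T := TensorProduct.map S 1) hS
    ((TensorProduct.mk K V W).flip (locExp T w)) (fun _ => rfl) v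
  simp only [TensorProduct.mk_apply, LinearMap.flip_apply] at hS' hT'
  rw [locExp_add (hS.map_left 1) (IsLocallyNilpotent.map_right 1 hT)
    ((Commute.one_right S).tensorProductMap (Commute.one_left T)), ← hT', ← hS']

theorem locExp_bijective [CharZero K] {T : Module.End K V} (hT : IsLocallyNilpotent T) :
    Function.Bijective (locExp T) := by
  have hneg : IsLocallyNilpotent (-T) := by simpa using hT.smul (-1)
  have hc : Commute T (-T) := (Commute.refl T).neg_right
  refine Function.bijective_iff_has_inverse.2 ⟨locExp (-T), fun v => ?_, fun v => ?_⟩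
  · rw [← locExp_add hneg hT hc.symm, neg_add_cancel, locExp_zero]
  · rw [← locExp_add hT hneg hc, add_neg_cancel, locExp_zero]

end LocallyNilpotent

section Polynomial

open scoped TensorProduct

variable {n : ℕ}

theorem isLocallyNilpotent_pderiv (i : Fin n) :
    IsLocallyNilpotent (pderiv (R := ℂ) i : Module.End ℂ (MvPolynomial (Fin n) ℂ)) := by
  intro F
  induction F using MvPolynomial.induction_on' with
  | monomial s a =>
    refine ⟨s i + 1, ?_⟩
    generalize hm : s i = m
    induction m generalizing s a with
    | zero => simp [pderiv_monomial, hm]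
    | succ m ih =>
      rw [pow_succ, Module.End.mul_apply]
      have : (pderiv (R := ℂ) i : Module.End ℂ (MvPolynomial (Fin n) ℂ)) (monomial s a)
          = monomial (s - Finsupp.single i 1) (a * s i) := pderiv_monomial
      rw [this]
      exact ih _ _ (by simp [hm])
  | add p q hp hq => exact IsLocallyNilpotent.exists_add hp hq

theorem commute_pderiv (i j : Fin n) :
    Commute (pderiv (R := ℂ) i : Module.End ℂ (MvPolynomial (Fin n) ℂ))
      (pderiv (R := ℂ) j : Module.End ℂ (MvPolynomial (Fin n) ℂ)) :=
  LinearMap.ext fun F => by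
    have h : ⁅pderiv (R := ℂ) i, pderiv (R := ℂ) j⁆ = 0 :=
      derivation_ext fun k => by
        classical
        simp [Derivation.commutator_apply, pderiv_X, Pi.single_apply, apply_ite]
    have hF := congrArg (fun E => E F) h
    simpa [Derivation.commutator_apply, sub_eq_zero] using hF

/-- The operator `L_D` as a linear endomorphism. -/
noncomputable def secondOrderEnd (D : Fin n → Fin n → ℂ) :
    Module.End ℂ (MvPolynomial (Fin n) ℂ) :=
  ∑ p : Fin n × Fin n, D p.1 p.2 •
    ((pderiv (R := ℂ) p.1 : Module.End ℂ (MvPolynomial (Fin n) ℂ)) *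
      (pderiv (R := ℂ) p.2 : Module.End ℂ (MvPolynomial (Fin n) ℂ)))

/-- The bidifferential operator `Σ C i j ∂_i ⊗ ∂_j`. -/
noncomputable def bidiffEnd (C : Fin n → Fin n → ℂ) :
    Module.End ℂ (MvPolynomial (Fin n) ℂ ⊗[ℂ] MvPolynomial (Fin n) ℂ) :=
  ∑ p : Fin n × Fin n, C p.1 p.2 • TensorProduct.map
    (pderiv (R := ℂ) p.1 : Module.End ℂ (MvPolynomial (Fin n) ℂ))
    (pderiv (R := ℂ) p.2 : Module.End ℂ (MvPolynomial (Fin n) ℂ))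

theorem secondOrderEnd_apply (D : Fin n → Fin n → ℂ) (F : MvPolynomial (Fin n) ℂ) :
    secondOrderEnd D F = secondOrderOp D F := by
  simp [secondOrderEnd, secondOrderOp, Fintype.sum_prod_type]

theorem bidiffEnd_tmul (C : Fin n → Fin n → ℂ) (F G : MvPolynomial (Fin n) ℂ) :
    bidiffEnd C (F ⊗ₜ[ℂ] G) = ∑ i, ∑ j, C i j • (pderiv i F ⊗ₜ[ℂ] pderiv j G) := by
  simp [bidiffEnd, Fintype.sum_prod_type]

theorem isLocallyNilpotent_secondOrderEnd (D : Fin n → Fin n → ℂ) :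
    IsLocallyNilpotent (secondOrderEnd D) := by
  refine IsLocallyNilpotent.sum_of_commute _ _ (fun p _ => ?_) fun p _ q _ => ?_
  · exact ((isLocallyNilpotent_pderiv p.2).mul_of_commute (commute_pderiv p.1 p.2)).smul _
  · have h (i : Fin n) := (commute_pderiv i q.1).mul_right (commute_pderiv i q.2)
    exact (((h p.1).mul_left (h p.2)).smul_right _).smul_left _

theorem isLocallyNilpotent_bidiffEnd (C : Fin n → Fin n → ℂ) :
    IsLocallyNilpotent (bidiffEnd C) := by
  refine IsLocallyNilpotent.sum_of_commute _ _ (fun p _ => ?_) fun p _ q _ => ?_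
  · exact ((isLocallyNilpotent_pderiv p.1).map_left _).smul _
  · refine Commute.smul_left (Commute.smul_right ?_ _) _
    exact (commute_pderiv _ _).tensorProductMap (commute_pderiv _ _)

theorem commute_bidiffEnd (C D : Fin n → Fin n → ℂ) : Commute (bidiffEnd C) (bidiffEnd D) :=
  Commute.sum_smul (fun _ _ => (commute_pderiv _ _).tensorProductMap (commute_pderiv _ _)) _ _

theorem commute_pderiv_secondOrderEnd (i : Fin n) (D : Fin n → Fin n → ℂ) :
    Commute (pderiv (R := ℂ) i : Module.End ℂ (MvPolynomial (Fin n) ℂ)) (secondOrderEnd D) :=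
  Commute.sum_right _ _ _ fun _ _ =>
    ((commute_pderiv _ _).mul_right (commute_pderiv _ _)).smul_right _

theorem bidiffEnd_add (C D : Fin n → Fin n → ℂ) :
    bidiffEnd (fun i j => C i j + D i j) = bidiffEnd C + bidiffEnd D := by
  simp only [bidiffEnd, add_smul, Finset.sum_add_distrib]

theorem expAlpha_eq_locExp (hbar : ℂ) (D : Fin n → Fin n → ℂ) (F : MvPolynomial (Fin n) ℂ) :
    expAlpha hbar D F = locExp ((hbar / 2) • secondOrderEnd D) F := by
  have hfun : ⇑(secondOrderEnd D) = secondOrderOp D := funext (secondOrderEnd_apply D)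
  refine finsum_congr fun k => ?_
  rw [smul_pow, LinearMap.smul_apply, smul_smul, Module.End.pow_apply, hfun, div_eq_inv_mul]

theorem pderivMulti_cons {k : ℕ} (r : Fin n) (i : Fin k → Fin n) (F : MvPolynomial (Fin n) ℂ) :
    pderivMulti (Fin.cons r i : Fin (k + 1) → Fin n) F = pderivMulti i (pderiv r F) := by
  simp [pderivMulti, List.ofFn_succ]

theorem sum_fin_cons {α M : Type*} [Fintype α] [AddCommMonoid M] {k : ℕ}
    (f : (Fin (k + 1) → α) → M) :
    ∑ i, f i = ∑ r : α, ∑ i : Fin k → α, f (Fin.cons r i) := by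
  rw [← (Fin.consEquiv fun _ => α).sum_comp, Fintype.sum_prod_type]
  rfl

theorem bidiffEnd_pow_tmul (C : Fin n → Fin n → ℂ) (k : ℕ) (F G : MvPolynomial (Fin n) ℂ) :
    (bidiffEnd C ^ k) (F ⊗ₜ[ℂ] G) = ∑ i : Fin k → Fin n, ∑ j : Fin k → Fin n,
      (∏ a : Fin k, C (i a) (j a)) • (pderivMulti i F ⊗ₜ[ℂ] pderivMulti j G) := by
  induction k generalizing F G with
  | zero => simp [pderivMulti]
  | succ k ih =>
    simp only [pow_succ, Module.End.mul_apply, bidiffEnd_tmul, map_sum, map_smul, ih,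
      sum_fin_cons, pderivMulti_cons, Fin.prod_univ_succ, Fin.cons_zero, Fin.cons_succ,
      Finset.smul_sum, smul_smul]
    exact Finset.sum_congr rfl fun r _ => Finset.sum_comm

theorem expProd_eq_locExp (hbar : ℂ) (C : Fin n → Fin n → ℂ) (F G : MvPolynomial (Fin n) ℂ) :
    expProd hbar C F G =
      LinearMap.mul' ℂ (MvPolynomial (Fin n) ℂ) (locExp (hbar • bidiffEnd C) (F ⊗ₜ[ℂ] G)) := by
  rw [map_locExp_eq_finsum ((isLocallyNilpotent_bidiffEnd C).smul hbar)]
  refine finsum_congr fun k => ?_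
  simp only [smul_pow, LinearMap.smul_apply, bidiffEnd_pow_tmul, map_smul, map_sum,
    LinearMap.mul'_apply, smul_smul, div_eq_inv_mul]

/-- The Leibniz rule for `L_D` when `D` is symmetric. -/
theorem secondOrderEnd_mul' (D : Fin n → Fin n → ℂ) (hD : ∀ i j, D i j = D j i) :
    secondOrderEnd D ∘ₗ LinearMap.mul' ℂ (MvPolynomial (Fin n) ℂ) =
      LinearMap.mul' ℂ (MvPolynomial (Fin n) ℂ) ∘ₗ
        (TensorProduct.map (secondOrderEnd D) 1 + TensorProduct.map 1 (secondOrderEnd D) +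
          (2 : ℂ) • bidiffEnd D) := by
  refine TensorProduct.ext' fun F G => ?_
  have hswap : ∑ i, ∑ j, D i j • (pderiv j F * pderiv i G) =
      ∑ i, ∑ j, D i j • (pderiv i F * pderiv j G) := by
    rw [Finset.sum_comm]
    exact Finset.sum_congr rfl fun i _ => Finset.sum_congr rfl fun j _ => by rw [hD]
  have hleib : secondOrderOp D (F * G) = secondOrderOp D F * G + F * secondOrderOp D G +
      (∑ i, ∑ j, D i j • (pderiv i F * pderiv j G) +
        ∑ i, ∑ j, D i j • (pderiv j F * pderiv i G)) := by
    simp only [secondOrderOp, Finset.sum_mul, Finset.mul_sum, ← Finset.sum_add_distrib]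
    refine Finset.sum_congr rfl fun i _ => Finset.sum_congr rfl fun j _ => ?_
    simp only [pderiv_mul, map_add, smul_eq_C_mul]
    ring
  simp only [LinearMap.comp_apply, LinearMap.mul'_apply, secondOrderEnd_apply, hleib, hswap,
    LinearMap.add_apply, TensorProduct.map_tmul, bidiffEnd_tmul, map_add,
    map_smul, map_sum, Module.End.one_apply, two_smul]

end Polynomial

/-- For symmetric `D`, the map `α_D` intertwines `⋆_C` with
`⋆_{C+D}`, and is a bijection; hence it is an algebra isomorphism from
`(ℂ[X], ⋆_C)` onto `(ℂ[X], ⋆_{C+D})`. -/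
theorem expAlpha_intertwines {n : ℕ} (hbar : ℂ)
    (C D : Fin n → Fin n → ℂ) (hD : ∀ i j, D i j = D j i) :
    (∀ F G : MvPolynomial (Fin n) ℂ,
      expAlpha hbar D (expProd hbar C F G)
        = expProd hbar (fun i j => C i j + D i j)
            (expAlpha hbar D F) (expAlpha hbar D G)) ∧
    Function.Bijective (expAlpha (n := n) hbar D) := by
  have hα : expAlpha (n := n) hbar D = locExp ((hbar / 2) • secondOrderEnd D) :=
    funext (expAlpha_eq_locExp hbar D)
  set L := (hbar / 2) • secondOrderEnd D with hL
  have hLN : IsLocallyNilpotent L := (isLocallyNilpotent_secondOrderEnd D).smul _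
  refine ⟨fun F G => ?_, hα ▸ locExp_bijective hLN⟩
  let L₁ : Module.End ℂ (TensorProduct ℂ (MvPolynomial (Fin n) ℂ) (MvPolynomial (Fin n) ℂ)) :=
    TensorProduct.map L 1
  let L₂ : Module.End ℂ (TensorProduct ℂ (MvPolynomial (Fin n) ℂ) (MvPolynomial (Fin n) ℂ)) :=
    TensorProduct.map 1 L
  have hL₁ : IsLocallyNilpotent L₁ := hLN.map_left 1
  have hL₂ : IsLocallyNilpotent L₂ := IsLocallyNilpotent.map_right 1 hLN
  have hL₁₂ : Commute L₁ L₂ := (Commute.one_right L).tensorProductMap (Commute.one_left L)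
  have hbi (E : Fin n → Fin n → ℂ) : IsLocallyNilpotent (hbar • bidiffEnd E) :=
    (isLocallyNilpotent_bidiffEnd E).smul _
  have hcomm (E : Fin n → Fin n → ℂ) : Commute (hbar • bidiffEnd E) (L₁ + L₂) := by
    refine Commute.smul_left (Commute.sum_left _ _ _ fun p _ => Commute.smul_left ?_ _) _
    exact (((commute_pderiv_secondOrderEnd _ D).smul_right _).tensorProductMap
      (Commute.one_right _)).add_right ((Commute.one_right _).tensorProductMap
        ((commute_pderiv_secondOrderEnd _ D).smul_right _))
  have hsum := hL₁.add_of_commute hL₂ hL₁₂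
  have hCD : Commute (hbar • bidiffEnd D) (hbar • bidiffEnd C) :=
    ((commute_bidiffEnd D C).smul_left _).smul_right _
  have hT : IsLocallyNilpotent (L₁ + L₂ + hbar • bidiffEnd D) :=
    hsum.add_of_commute (hbi D) (hcomm D).symm
  have hmul (x : TensorProduct ℂ (MvPolynomial (Fin n) ℂ) (MvPolynomial (Fin n) ℂ)) :
      LinearMap.mul' ℂ (MvPolynomial (Fin n) ℂ) ((L₁ + L₂ + hbar • bidiffEnd D) x) =
        L (LinearMap.mul' ℂ (MvPolynomial (Fin n) ℂ) x) := by
    have h := congrArg (fun f => (hbar / 2) • f x) (secondOrderEnd_mul' D hD)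
    have hLL : L₁ + L₂ + hbar • bidiffEnd D = (hbar / 2) • (TensorProduct.map
        (secondOrderEnd D) 1 + TensorProduct.map 1 (secondOrderEnd D) +
          (2 : ℂ) • bidiffEnd D) := by
      simp only [L₁, L₂, hL, TensorProduct.map_smul_left, TensorProduct.map_smul_right, smul_add,
        smul_smul, div_mul_cancel₀ hbar (two_ne_zero (α := ℂ))]
    rw [hLL, LinearMap.smul_apply, map_smul]
    exact h.symm
  rw [hα, expProd_eq_locExp, expProd_eq_locExp, ← map_locExp hT _ hmul,
    ← locExp_add hT (hbi C) ((hcomm C).symm.add_left hCD), ← locExp_tmul hLN hLN,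
    ← locExp_add (hbi _) hsum (hcomm _), bidiffEnd_add, smul_add]
  congr 2
  abel
end

section
/- Fix n ∈ ℕ, a complex number ħ, and a matrix C : Fin n → Fin n → ℂ. Suppose v : Fin n → ℂ satisfies Σ_i v_i · C i j = 0 for every j and Σ_j C i j · v_j = 0 for every i (v lies in the radical of C). Then the linear polynomial ℓ := Σ_i v_i · X_i satisfies ℓ ⋆_C F = ℓ · F and F ⋆_C ℓ = F · ℓ for every polynomial F. (This is the algebraic mechanism by which, since the causal propagator is a bisolution of the equation of motion, observables of the form O_{Pf} star-multiply trivially, so that the Koszul differential δ_S is a derivation with respect to the star product.) -/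
open MvPolynomial

theorem pderiv_linear {n : ℕ} (v : Fin n → ℂ) (r : Fin n) :
    pderiv r (∑ i : Fin n, MvPolynomial.C (v i) * MvPolynomial.X i) =
      MvPolynomial.C (v r) := by
  simp [pderiv_X, Pi.single_apply]

theorem foldl_pderiv_zero {n : ℕ} (l : List (Fin n)) :
    l.foldl (fun p r => pderiv r p) (0 : MvPolynomial (Fin n) ℂ) = 0 := by
  induction l with
  | nil => rfl
  | cons r l ih => simpa using ih

theorem pderivMulti_fin_zero {n : ℕ} (i : Fin 0 → Fin n) (F : MvPolynomial (Fin n) ℂ) :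
    pderivMulti i F = F := by
  simp [pderivMulti]

theorem pderivMulti_fin_one {n : ℕ} (i : Fin 1 → Fin n) (F : MvPolynomial (Fin n) ℂ) :
    pderivMulti i F = pderiv (i 0) F := by
  simp [pderivMulti]

/-- Iterated derivatives of order at least two annihilate linear polynomials. -/
theorem pderivMulti_linear {n k : ℕ} (v : Fin n → ℂ) (i : Fin (k + 2) → Fin n) :
    pderivMulti i (∑ i : Fin n, MvPolynomial.C (v i) * MvPolynomial.X i) = 0 := by
  simp only [pderivMulti, List.ofFn_succ, List.foldl_cons, pderiv_linear, pderiv_C,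
    foldl_pderiv_zero]

/-- The exponential product is the ordinary product when all terms of positive order vanish. -/
theorem expProd_eq_mul {n : ℕ} (hbar : ℂ) (C : Fin n → Fin n → ℂ)
    (F G : MvPolynomial (Fin n) ℂ)
    (hone : ∑ r : Fin n, ∑ s : Fin n, C r s • (pderiv r F * pderiv s G) = 0)
    (htwo : ∀ (k : ℕ) (i j : Fin (k + 2) → Fin n), pderivMulti i F * pderivMulti j G = 0) :
    expProd hbar C F G = F * G := by
  rw [expProd, finsum_eq_single _ 0]
  · simp [pderivMulti_fin_zero]
  · rintro (_ | _ | k) hk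
    · exact absurd rfl hk
    · have h : ∑ i : Fin 1 → Fin n, ∑ j : Fin 1 → Fin n,
          (∏ a : Fin 1, C (i a) (j a)) • (pderivMulti i F * pderivMulti j G) = 0 := by
        rw [← hone, ← (Equiv.funUnique (Fin 1) (Fin n)).sum_comp]
        refine Finset.sum_congr rfl fun i _ => ?_
        rw [← (Equiv.funUnique (Fin 1) (Fin n)).sum_comp]
        refine Finset.sum_congr rfl fun j _ => ?_
        simp [pderivMulti_fin_one]
      exact (congrArg _ h).trans (smul_zero _)
    · simp [htwo]

/-- If `v` lies in the radical of the propagator `C`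
(`Σ_i vᵢ C i j = 0` for all `j` and `Σ_j C i j vⱼ = 0` for all `i`), then the
linear polynomial `ℓ = Σ vᵢ Xᵢ` star-multiplies trivially: `ℓ ⋆_C F = ℓ · F`
and `F ⋆_C ℓ = F · ℓ` for every polynomial `F`. -/
theorem expProd_radical_linear {n : ℕ} (hbar : ℂ)
    (C : Fin n → Fin n → ℂ) (v : Fin n → ℂ)
    (hleft : ∀ j : Fin n, ∑ i : Fin n, v i * C i j = 0)
    (hright : ∀ i : Fin n, ∑ j : Fin n, C i j * v j = 0) :
    letI ℓ : MvPolynomial (Fin n) ℂ :=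
      ∑ i : Fin n, MvPolynomial.C (v i) * MvPolynomial.X i
    ∀ F : MvPolynomial (Fin n) ℂ,
      expProd hbar C ℓ F = ℓ * F ∧ expProd hbar C F ℓ = F * ℓ := by
  intro F
  constructor
  · refine expProd_eq_mul hbar C _ F ?_ fun k i j => by rw [pderivMulti_linear, zero_mul]
    rw [Finset.sum_comm]
    refine Finset.sum_eq_zero fun s _ => ?_
    simp only [pderiv_linear]
    simp only [MvPolynomial.C_mul', smul_smul, ← Finset.sum_smul, mul_comm (C _ s), hleft,
      zero_smul]
  · refine expProd_eq_mul hbar C F _ ?_ fun k i j => by rw [pderivMulti_linear, mul_zero]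
    refine Finset.sum_eq_zero fun r _ => ?_
    simp only [pderiv_linear]
    simp only [mul_comm _ (MvPolynomial.C _), MvPolynomial.C_mul', smul_smul,
      ← Finset.sum_smul, hright, zero_smul]
end
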